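/- arXiv:2108.06646 — 4 statements merged into one kernel-verified Lean document; each statement's English description precedes it below -/
import Mathlib

section
/- Let φ₁ be the binary morphism with φ₁(0) = 01100100101101001011010010 and φ₁(1) = 0110101100110101100101001100101001. If w is a cubefree binary word and p is a nonempty prefix of w, then φ₁(p) is an irreducible cubefree binary word. -/
/-- A cube is a word of the form XXX with X nonempty. -/
def IsCube {α : Type*} (w : List α) : Prop :=
  ∃ X : List α, X ≠ [] ∧ w = X ++ X ++ X

/-- A word contains a cube if some factor (contiguous subword) of it is a cube. -/
def HasCube {α : Type*} (w : List α) : Prop :=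
  ∃ u, u <:+: w ∧ IsCube u

/-- A word is cubefree if none of its factors is a cube. -/
def CubeFree {α : Type*} (w : List α) : Prop := ¬ HasCube w

/-- An irreducible cubefree word: a cubefree word of length at least 3
such that removing any one interior letter creates a cube. -/
def IrreducibleCubeFree (w : List (Fin 2)) : Prop :=
  CubeFree w ∧ 3 ≤ w.length ∧
    ∀ i : ℕ, 0 < i → i + 1 < w.length → HasCube (w.eraseIdx i)

/-- Apply the binary morphism determined by letter images `h` to a word. -/
def applyMorphism {α : Type*} (h : α → List α) (w : List α) : List α := w.flatMap h

/-- The binary morphism φ₁, given by its images of the letters 0 and 1. -/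
def phi1 : Fin 2 → List (Fin 2) := fun a =>
  if a = 0 then [0,1,1,0,0,1,0,0,1,0,1,1,0,1,0,0,1,0,1,1,0,1,0,0,1,0]
  else [0,1,1,0,1,0,1,1,0,0,1,1,0,1,0,1,1,0,0,1,0,1,0,0,1,1,0,0,1,0,1,0,0,1]

theorem HasCube.of_infix {α : Type*} {u v : List α} (h : HasCube u) (huv : u <:+: v) :
    HasCube v := by
  obtain ⟨x, hx, hc⟩ := h
  exact ⟨x, hx.trans huv, hc⟩

theorem CubeFree.of_infix {α : Type*} {u v : List α} (h : CubeFree v) (huv : u <:+: v) :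
    CubeFree u := fun hu => h (hu.of_infix huv)

/-- Boolean test for a factor `X ++ X ++ X` with `0 < X.length ≤ n`. -/
def hasShortCube {α : Type*} [DecidableEq α] (n : ℕ) : List α → Bool
  | [] => false
  | a :: t =>
    ((List.range n).any fun q =>
      ((a :: t.take q) ++ (a :: t.take q)).isPrefixOf (t.drop q)) || hasShortCube n t

theorem hasCube_of_hasShortCube {α : Type*} [DecidableEq α] {n : ℕ} {l : List α}
    (h : hasShortCube n l = true) : HasCube l := by
  induction l with
  | nil => simp [hasShortCube] at h
  | cons a t ih =>
    rw [hasShortCube, Bool.or_eq_true] at h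
    rcases h with h | h
    · obtain ⟨q, -, hq⟩ := List.any_eq_true.1 h
      obtain ⟨r, hr⟩ := List.isPrefixOf_iff_prefix.1 hq
      refine ⟨_, ⟨[], r, ?_⟩, a :: t.take q, by simp, rfl⟩
      rw [List.nil_append, List.append_assoc (a :: t.take q), List.append_assoc (a :: t.take q), hr]
      simp
    · exact (ih h).of_infix (List.suffix_cons a t).isInfix

theorem hasShortCube_of_infix {α : Type*} [DecidableEq α] {n : ℕ} {l X : List α}
    (hX : X ≠ []) (hn : X.length ≤ n) (h : X ++ X ++ X <:+: l) : hasShortCube n l = true := by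
  induction l with
  | nil => simp_all
  | cons a t ih =>
    rw [hasShortCube, Bool.or_eq_true]
    rcases List.infix_cons_iff.1 h with h | h
    · left
      obtain ⟨r, hr⟩ := h
      obtain ⟨b, Y, rfl⟩ := List.exists_cons_of_ne_nil hX
      simp only [List.cons_append, List.cons.injEq] at hr
      obtain ⟨rfl, rfl⟩ := hr
      refine List.any_eq_true.2 ⟨Y.length, by simpa using hn, ?_⟩
      rw [List.isPrefixOf_iff_prefix]
      exact ⟨r, by simp⟩
    · exact Or.inr (ih h)

theorem phi1_length_ge (d : Fin 2) : 26 ≤ (phi1 d).length := by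
  revert d; decide

theorem phi1_length_le (d : Fin 2) : (phi1 d).length ≤ 34 := by
  revert d; decide

theorem phi1_getLast?_injective {d e : Fin 2}
    (h : (phi1 d).getLast? = (phi1 e).getLast?) : d = e := by
  revert d e; decide

theorem eq_of_phi1_append_prefix {d e : Fin 2} {s t : List (Fin 2)}
    (h : phi1 d ++ s <+: phi1 e ++ t) : d = e := by
  fin_cases d <;> fin_cases e <;> simp [phi1] at h ⊢

theorem prefix_of_flatMap_phi1_prefix {u y : List (Fin 2)}
    (h : u.flatMap phi1 <+: y.flatMap phi1) : u <+: y := by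
  induction u generalizing y with
  | nil => simp
  | cons a u ih =>
    cases y with
    | nil =>
      have h1 := h.length_le
      have h2 := phi1_length_ge a
      simp at h1
      simp [h1] at h2
    | cons b y =>
      rw [List.flatMap_cons, List.flatMap_cons] at h
      obtain rfl := eq_of_phi1_append_prefix h
      rw [List.prefix_append_right_inj] at h
      simpa using ih h

/-- Every cut of `φ₁(p)` falls inside (or at the start of) the image of some letter of `p`. -/
theorem exists_cut_of_flatMap_phi1_eq {p s r : List (Fin 2)} (h : p.flatMap phi1 = s ++ r)
    (hr : r ≠ []) :
    ∃ p₁ d p₂ k, k < (phi1 d).length ∧ p = p₁ ++ d :: p₂ ∧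
      s = p₁.flatMap phi1 ++ (phi1 d).take k ∧ r = (phi1 d).drop k ++ p₂.flatMap phi1 := by
  induction p generalizing s with
  | nil => simp_all
  | cons d p ih =>
    rw [List.flatMap_cons] at h
    rcases lt_or_ge s.length (phi1 d).length with hs | hs
    · obtain ⟨c, hc⟩ := List.prefix_of_prefix_length_le (⟨r, rfl⟩ : s <+: s ++ r)
        (h ▸ List.prefix_append _ _) hs.le
      refine ⟨[], d, p, s.length, hs, rfl, ?_, ?_⟩
      · simp [← hc]
      · rw [← hc, List.append_assoc, List.append_cancel_left_eq] at h
        simp [← hc, h]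
    · obtain ⟨s', rfl⟩ := List.prefix_of_prefix_length_le
        (h ▸ List.prefix_append _ _ : phi1 d <+: s ++ r) ⟨r, rfl⟩ hs
      rw [List.append_assoc, List.append_cancel_left_eq] at h
      obtain ⟨p₁, e, p₂, k, hk, rfl, rfl, hr'⟩ := ih h
      exact ⟨d :: p₁, e, p₂, k, hk, rfl, by simp, hr'⟩

theorem take_drop_phi1_ne (a d : Fin 2) {k : ℕ} (hk : 0 < k) (hkd : k < (phi1 d).length) :
    ((phi1 d).drop k).take 12 ≠ (phi1 a).take 12 ∧
      ∀ b, ((phi1 d).drop k ++ phi1 b).take 12 ≠ (phi1 a).take 12 := by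
  have key : ∀ k < 34, ∀ a d, 0 < k → k < (phi1 d).length →
      ((phi1 d).drop k).take 12 ≠ (phi1 a).take 12 ∧
        ∀ b, ((phi1 d).drop k ++ phi1 b).take 12 ≠ (phi1 a).take 12 := by
    decide +kernel
  exact key k (hkd.trans_le (phi1_length_le d)) a d hk hkd

theorem take_flatMap_phi1_cons (x : List (Fin 2)) (b : Fin 2) (y : List (Fin 2)) :
    (x ++ (b :: y).flatMap phi1).take 12 = (x ++ phi1 b).take 12 := by
  have := phi1_length_ge b
  rw [List.flatMap_cons, ← List.append_assoc, List.take_append_of_le_length]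
  simp only [List.length_append]
  omega

/-- The first twelve letters of `φ₁(p)` reoccur in `φ₁(p)` only at block boundaries. -/
theorem exists_boundary_of_take_eq {p z r : List (Fin 2)} (h : p.flatMap phi1 = z ++ r)
    (hr : r ≠ []) (ht : r.take 12 = (p.flatMap phi1).take 12) :
    ∃ u v, p = u ++ v ∧ u.flatMap phi1 = z ∧ v.flatMap phi1 = r := by
  obtain ⟨p₁, d, p₂, k, hk, hp, rfl, rfl⟩ := exists_cut_of_flatMap_phi1_eq h hr
  rcases Nat.eq_zero_or_pos k with rfl | hk0
  · exact ⟨p₁, d :: p₂, hp, by simp, by simp⟩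
  · exfalso
    obtain ⟨a, y, rfl⟩ : ∃ a y, p = a :: y := List.exists_cons_of_ne_nil (by simp [hp])
    have ha := take_flatMap_phi1_cons [] a y
    rw [List.nil_append, List.nil_append] at ha
    rw [ha] at ht
    have hne := take_drop_phi1_ne a d hk0 hk
    cases p₂ with
    | nil => exact hne.1 (by simpa using ht)
    | cons b p₂ => exact hne.2 b (by rw [← ht, take_flatMap_phi1_cons])

/-- Boolean test, over all extensions of `v` to the left by at most `n` letters, that a word
without short cubes has an image under `φ₁` without cubes of period at most 45. -/
def imagesAvoidShortCubes : ℕ → List (Fin 2) → Bool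
  | 0, v => hasShortCube 1 v || !hasShortCube 45 (v.flatMap phi1)
  | n + 1, v => (hasShortCube 1 v || !hasShortCube 45 (v.flatMap phi1)) &&
      imagesAvoidShortCubes n (0 :: v) && imagesAvoidShortCubes n (1 :: v)

theorem hasShortCube_eq_false_of_imagesAvoidShortCubes {n : ℕ} {v : List (Fin 2)}
    (h : imagesAvoidShortCubes n v = true) (u : List (Fin 2)) (hu : u.length ≤ n)
    (hc : CubeFree (u ++ v)) : hasShortCube 45 ((u ++ v).flatMap phi1) = false := by
  induction n generalizing u v with
  | zero =>
    obtain rfl := List.length_eq_zero_iff.1 (Nat.le_zero.1 hu)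
    rw [imagesAvoidShortCubes, Bool.or_eq_true] at h
    rcases h with h | h
    · exact absurd (hasCube_of_hasShortCube h) hc
    · simpa using h
  | succ n ih =>
    rw [imagesAvoidShortCubes, Bool.and_eq_true, Bool.and_eq_true, Bool.or_eq_true] at h
    obtain ⟨⟨h, h0⟩, h1⟩ := h
    rcases List.eq_nil_or_concat u with rfl | ⟨u, a, rfl⟩
    · rcases h with h | h
      · exact absurd (hasCube_of_hasShortCube h) hc
      · simpa using h
    · rw [List.concat_eq_append, List.append_assoc] at hc ⊢
      have hu' : u.length ≤ n := by simpa using hu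
      fin_cases a
      · exact ih h0 u hu' hc
      · exact ih h1 u hu' hc

theorem imagesAvoidShortCubes_five : imagesAvoidShortCubes 5 [] = true := by
  decide +kernel

theorem prefix_flatMap_phi1_take {c u p : List (Fin 2)} {n : ℕ}
    (h : u <+: c ++ p.flatMap phi1) (hu : u.length ≤ c.length + 26 * n) :
    u <+: c ++ (p.take n).flatMap phi1 := by
  induction n generalizing c p with
  | zero =>
    exact (List.prefix_of_prefix_length_le h (List.prefix_append _ _) (by simpa using hu)).trans
      (List.prefix_append _ _)
  | succ n ih =>
    cases p with
    | nil => simpa using h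
    | cons a p =>
      have := phi1_length_ge a
      rw [List.flatMap_cons, ← List.append_assoc] at h
      rw [List.take_succ_cons, List.flatMap_cons, ← List.append_assoc]
      refine ih h ?_
      rw [List.length_append]
      omega

theorem CubeFree.flatMap_phi1 {p : List (Fin 2)} (hp : CubeFree p) :
    CubeFree (p.flatMap phi1) := by
  rintro ⟨_, ⟨s, t, hst⟩, X, hX, rfl⟩
  obtain ⟨p₁, d, p₂, k, hk, rfl, -, hr⟩ := exists_cut_of_flatMap_phi1_eq
    (s := s) (r := X ++ X ++ X ++ t) (by rw [← hst]; simp) (by simp [hX])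
  set c := (phi1 d).drop k with hc
  have hcd : c <:+ phi1 d := List.drop_suffix _ _
  have hc34 : c.length ≤ 34 := hcd.length_le.trans (phi1_length_le d)
  have hc0 : c ≠ [] := by
    rw [hc, Ne, List.drop_eq_nil_iff]
    omega
  rcases lt_or_ge X.length (c.length + 12) with hq | hq
  · have hpre : X ++ X ++ X <+: c ++ (p₂.take 4).flatMap phi1 :=
      prefix_flatMap_phi1_take (hr ▸ List.prefix_append _ _)
        (by simp only [List.length_append]; omega)
    have hinf : X ++ X ++ X <:+: (d :: p₂.take 4 ++ []).flatMap phi1 := by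
      obtain ⟨c', hc'⟩ := hcd
      refine hpre.isInfix.trans ⟨c', [], ?_⟩
      simp [← hc']
    have hfree : CubeFree (d :: p₂.take 4 ++ []) := by
      refine hp.of_infix ⟨p₁, p₂.drop 4, ?_⟩
      simp
    have h := hasShortCube_eq_false_of_imagesAvoidShortCubes imagesAvoidShortCubes_five
      (d :: p₂.take 4) (by simp) hfree
    rw [hasShortCube_of_infix hX (by omega) hinf] at h
    exact Bool.noConfusion h
  · obtain ⟨Y, rfl⟩ : c <+: X := List.prefix_of_prefix_length_le
      (hr ▸ List.prefix_append _ _ : c <+: X ++ X ++ X ++ t)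
      ⟨X ++ X ++ t, by simp⟩ (by omega)
    have hY : 12 ≤ Y.length := by
      rw [List.length_append] at hq
      omega
    have hp₂ : p₂.flatMap phi1 = (Y ++ c) ++ (Y ++ (c ++ (Y ++ t))) := by
      simp only [List.append_assoc, List.append_cancel_left_eq] at hr
      simp [← hr]
    obtain ⟨u, p₃, rfl, hu, hp₃⟩ := exists_boundary_of_take_eq hp₂ (by simp [hc0]) (by
      rw [hp₂, List.append_assoc, List.take_append_of_le_length hY,
        List.take_append_of_le_length hY])
    obtain ⟨p₄, rfl⟩ : u <+: p₃ := prefix_of_flatMap_phi1_prefix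
      ⟨Y ++ t, by rw [hu, hp₃]; simp⟩
    have hp₄ : p₄.flatMap phi1 = Y ++ t := by
      rw [List.flatMap_append, hu] at hp₃
      simpa using hp₃
    rcases List.eq_nil_or_concat u with rfl | ⟨v, e, rfl⟩
    · simp [hc0] at hu
    rw [List.concat_eq_append, List.flatMap_append, List.flatMap_singleton] at hu
    have hlast : ∀ x : List (Fin 2), (x ++ c).getLast? = c.getLast? := fun x => by
      rw [List.getLast?_append, List.getLast?_eq_getLast_of_ne_nil hc0, Option.some_or]
    obtain rfl : d = e := by
      apply phi1_getLast?_injective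
      have he0 : phi1 e ≠ [] := fun h => by simpa [h] using phi1_length_ge e
      have h1 : (v.flatMap phi1 ++ phi1 e).getLast? = (phi1 e).getLast? := by
        rw [List.getLast?_append, List.getLast?_eq_getLast_of_ne_nil he0, Option.some_or]
      obtain ⟨x, hx⟩ := hcd
      rw [← h1, hu, hlast, ← hx, hlast]
    have hvY : v.flatMap phi1 <+: Y := by
      refine List.prefix_of_prefix_length_le (hu ▸ List.prefix_append _ _)
        (List.prefix_append Y c) ?_
      have h1 := congrArg List.length hu
      have h2 := hcd.length_le
      simp only [List.length_append] at h1
      omega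
    obtain ⟨p₅, rfl⟩ : v <+: p₄ := prefix_of_flatMap_phi1_prefix
      (hp₄ ▸ hvY.trans (List.prefix_append _ _))
    exact hp ⟨_, ⟨p₁, p₅, by simp⟩, d :: v, by simp, rfl⟩

theorem hasCube_eraseIdx_phi1 (d : Fin 2) {i : ℕ} (hi : 0 < i) (h : i + 1 < (phi1 d).length) :
    HasCube ((phi1 d).eraseIdx i) := by
  have hi' : i < 34 := by have := phi1_length_le d; omega
  have key : ∀ i < 34, ∀ d, 0 < i → i + 1 < (phi1 d).length →
      hasShortCube 8 (((phi1 d).eraseIdx i).drop (i - 23)) = true := by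
    decide +kernel
  exact (hasCube_of_hasShortCube (key i hi' d hi h)).of_infix (List.drop_suffix _ _).isInfix

theorem hasCube_eraseIdx_phi1_append (d e : Fin 2) {i : ℕ} (hi : 0 < i)
    (h : i + 1 < (phi1 d ++ phi1 e).length) : HasCube ((phi1 d ++ phi1 e).eraseIdx i) := by
  have hi' : i < 68 := by
    have := phi1_length_le d
    have := phi1_length_le e
    rw [List.length_append] at h
    omega
  have key : ∀ i < 68, ∀ d e, 0 < i → i + 1 < (phi1 d ++ phi1 e).length →
      hasShortCube 8 (((phi1 d ++ phi1 e).eraseIdx i).drop (i - 23)) = true := by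
    decide +kernel
  exact (hasCube_of_hasShortCube (key i hi' d e hi h)).of_infix (List.drop_suffix _ _).isInfix

theorem hasCube_eraseIdx_flatMap_phi1 (p : List (Fin 2)) {i : ℕ} (hi : 0 < i)
    (h : i + 1 < (p.flatMap phi1).length) : HasCube ((p.flatMap phi1).eraseIdx i) := by
  induction p generalizing i with
  | nil => simp at h
  | cons d p ih =>
    cases p with
    | nil =>
      rw [List.flatMap_singleton] at h ⊢
      exact hasCube_eraseIdx_phi1 d hi h
    | cons e p =>
      rcases lt_or_ge (i + 1) (phi1 d ++ phi1 e).length with hlt | hge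
      · rw [List.flatMap_cons, List.flatMap_cons, ← List.append_assoc,
          List.eraseIdx_append_of_lt_length (by omega)]
        exact (hasCube_eraseIdx_phi1_append d e hi hlt).of_infix
          (List.prefix_append _ _).isInfix
      · have he := phi1_length_ge e
        rw [List.length_append] at hge
        rw [List.flatMap_cons, List.length_append] at h
        rw [List.flatMap_cons, List.eraseIdx_append_of_length_le (by omega)]
        exact (ih (by omega) (by omega)).of_infix (List.suffix_append _ _).isInfix

theorem phi1_prefix_irreducible (w p : List (Fin 2)) (hw : CubeFree w)
    (hp : p <+: w) (hne : p ≠ []) :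
    IrreducibleCubeFree (applyMorphism phi1 p) := by
  refine ⟨(hw.of_infix hp.isInfix).flatMap_phi1, ?_, fun i => hasCube_eraseIdx_flatMap_phi1 p⟩
  obtain ⟨a, q, rfl⟩ := List.exists_cons_of_ne_nil hne
  have := phi1_length_ge a
  rw [applyMorphism, List.flatMap_cons, List.length_append]
  omega
end

section
/- A ternary morphism preserves squarefreeness if and only if the images of all squarefree ternary words of length 5 are squarefree; that is, for a monoid morphism f from ternary words to ternary words, f(w) is squarefree for every squarefree word w if and only if f(u) is squarefree for every squarefree word u of length 5. -/
/-- A square is a word of the form XX with X nonempty. -/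
def IsSquare' {α : Type*} (w : List α) : Prop :=
  ∃ X : List α, X ≠ [] ∧ w = X ++ X

/-- A word contains a square if some factor (contiguous subword) of it is a square. -/
def HasSquare {α : Type*} (w : List α) : Prop :=
  ∃ u, u <:+: w ∧ IsSquare' u

/-- A word is squarefree if none of its factors is a square. -/
def SquareFree' {α : Type*} (w : List α) : Prop := ¬ HasSquare w

namespace SquareFree'

variable {α β : Type*}

theorem of_infix {u w : List α} (hw : SquareFree' w) (h : u <:+: w) : SquareFree' u :=
  fun ⟨x, hx, hs⟩ => hw ⟨x, hx.trans h, hs⟩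

theorem eq_nil_of_append {w X : List α} (hw : SquareFree' w) (a b : List α)
    (h : w = a ++ (X ++ (X ++ b))) : X = [] := by
  by_contra hX
  exact hw ⟨X ++ X, ⟨a, b, by simp [h]⟩, X, hX, rfl⟩

theorem isChain_ne {w : List α} (hw : SquareFree' w) : w.IsChain (· ≠ ·) := by
  rw [List.isChain_iff_forall_rel_of_append_cons_cons]
  rintro a b l₁ l₂ rfl rfl
  simpa using hw.eq_nil_of_append (X := [a]) l₁ l₂ (by simp)

end SquareFree'

/-- The images under `φ` of all squarefree words of length three are squarefree. -/
def SquareFreeOnTriples {α β : Type*} (φ : α → List β) : Prop :=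
  ∀ a b c, a ≠ b → b ≠ c → SquareFree' (φ a ++ (φ b ++ φ c))

namespace SquareFreeOnTriples

variable {α β : Type*} {φ : α → List β}

theorem pair (h : SquareFreeOnTriples φ) {a b : α} (hab : a ≠ b) :
    SquareFree' (φ a ++ φ b) :=
  (h a b a hab hab.symm).of_infix ⟨[], φ a, by simp⟩

theorem eq_of_overlap (h : SquareFreeOnTriples φ) {a b : α} {y : List β} (hy : y ≠ [])
    (ha : y <:+ φ a) (hb : y <+: φ b) : a = b := by
  by_contra hab
  obtain ⟨s, hs⟩ := ha
  obtain ⟨t, ht⟩ := hb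
  exact hy ((h.pair hab).eq_nil_of_append s t (by simp [← hs, ← ht]))

theorem eq_of_prefix (h : SquareFreeOnTriples φ) {a b : α} (ha : φ a ≠ [])
    (hb : φ a <+: φ b) : a = b :=
  h.eq_of_overlap ha List.suffix_rfl hb

theorem eq_of_suffix (h : SquareFreeOnTriples φ) {a b : α} (ha : φ a ≠ [])
    (hb : φ a <:+ φ b) : a = b :=
  (h.eq_of_overlap ha hb List.prefix_rfl).symm

theorem not_border_append_prefix (h : SquareFreeOnTriples φ) {c z : α} {y : List β} (hy : y ≠ [])
    (h₁ : y <:+ φ c) : ¬ y ++ φ z <+: φ c := by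
  intro h₂
  have hyl := List.length_pos_iff.2 hy
  have hzc : c ≠ z := by
    rintro rfl
    have := h₂.length_le
    simp only [List.length_append] at this
    omega
  obtain ⟨s, hs⟩ := h₁
  obtain ⟨t, ht⟩ := h₂
  have := (h c z c hzc hzc.symm).eq_nil_of_append (X := y ++ φ z) s t
    (by nth_rw 2 [← ht]; simp [← hs])
  simp_all

theorem not_append_border_suffix (h : SquareFreeOnTriples φ) {c z : α} {y : List β} (hy : y ≠ [])
    (h₁ : y <+: φ c) : ¬ φ z ++ y <:+ φ c := by
  intro h₂
  have hyl := List.length_pos_iff.2 hy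
  have hzc : c ≠ z := by
    rintro rfl
    have := h₂.length_le
    simp only [List.length_append] at this
    omega
  obtain ⟨s, hs⟩ := h₁
  obtain ⟨t, ht⟩ := h₂
  have := (h c z c hzc hzc.symm).eq_nil_of_append (X := φ z ++ y) t s
    (by nth_rw 1 [← ht]; simp [← hs])
  simp_all

/-- Two parses of the same word into `φ`-blocks, incomplete at both ends and with at least one
complete block, share a cut. -/
theorem exists_common_cut (h : SquareFreeOnTriples φ) {A B C D : α} {u v : List α}
    {p q r s : List β} (hu : (A :: (u ++ [B])).IsChain (· ≠ ·))
    (hv : (C :: (v ++ [D])).IsChain (· ≠ ·)) (hp : p <:+ φ A) (hq : q <+: φ B)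
    (hr : r <:+ φ C) (hs : s <+: φ D) (huv : 0 < u.length + v.length)
    (e : p ++ (u.flatMap φ ++ q) = r ++ (v.flatMap φ ++ s)) :
    ∃ u₁ u₂ v₁ v₂, u = u₁ ++ u₂ ∧ v = v₁ ++ v₂ ∧
      p ++ u₁.flatMap φ = r ++ v₁.flatMap φ ∧ u₂.flatMap φ ++ q = v₂.flatMap φ ++ s := by
  induction hn : u.length + v.length using Nat.strong_induction_on
    generalizing A B C D u v p q r s with
  | _ n ih =>
  wlog hpr : p.length ≤ r.length generalizing A B C D u v p q r s
  · obtain ⟨v₁, v₂, u₁, u₂, hv', hu', h₁, h₂⟩ :=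
      this hv hu hr hs hp hq (by omega) e.symm (by omega) (by omega)
    exact ⟨u₁, u₂, v₁, v₂, hu', hv', h₁.symm, h₂.symm⟩
  obtain ⟨y, rfl⟩ : p <+: r :=
    List.prefix_of_prefix_length_le (l₃ := r ++ (v.flatMap φ ++ s)) ⟨_, e⟩ ⟨_, rfl⟩ hpr
  have e' : u.flatMap φ ++ q = y ++ (v.flatMap φ ++ s) := by simpa using e
  by_cases hy : y = []
  · subst hy
    exact ⟨[], u, [], v, by simp, by simp, by simp, by simpa using e'⟩
  have hyC : y <:+ φ C := (List.suffix_append p y).trans hr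
  cases u with
  | nil =>
    cases v with
    | nil => simp at huv
    | cons z v =>
      have hyB : y ++ φ z <+: φ B :=
        List.IsPrefix.trans ⟨v.flatMap φ ++ s, by simpa using e'.symm⟩ hq
      obtain rfl := h.eq_of_overlap hy hyC ((List.prefix_append _ _).trans hyB)
      exact (h.not_border_append_prefix hy hyC hyB).elim
  | cons z u =>
    by_cases h0 : 0 < u.length + v.length
    · obtain ⟨u₁, u₂, v₁, v₂, rfl, rfl, h₁, h₂⟩ := ih _ (by simp at hn; omega)
        (A := z) (p := φ z) (u := u) hu.tail hv List.suffix_rfl hq hyC hs h0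
        (by simpa using e') rfl
      exact ⟨z :: u₁, u₂, v₁, v₂, by simp, rfl, by simp [h₁], h₂⟩
    · obtain rfl : u = [] := List.length_eq_zero_iff.1 (by omega)
      obtain rfl : v = [] := List.length_eq_zero_iff.1 (by omega)
      simp only [List.flatMap_cons, List.flatMap_nil, List.append_nil, List.nil_append] at e'
      rcases List.append_eq_append_iff.1 e' with ⟨x, rfl, rfl⟩ | ⟨x, hx, rfl⟩
      · by_cases hx : x = []
        · subst hx
          exact ⟨[z], [], [], [], by simp, by simp, by simp, by simp⟩
        have hxB := (List.prefix_append x s).trans hq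
        obtain rfl := h.eq_of_overlap hx ((List.suffix_append _ x).trans hyC) hxB
        exact (h.not_append_border_suffix hx hxB hyC).elim
      · by_cases hx0 : x = []
        · subst hx0
          exact ⟨[z], [], [], [], by simp, by simp, by simp [hx], by simp⟩
        have h₁ := h.eq_of_overlap hy hyC (hx ▸ List.prefix_append y x)
        have h₂ := h.eq_of_overlap hx0 (hx ▸ List.suffix_append y x)
          ((List.prefix_append x q).trans hs)
        simp [h₁, h₂] at hv

theorem eq_of_flatMap_append_eq (h : SquareFreeOnTriples φ) (hφ : ∀ a, φ a ≠ []) {B D : α}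
    {u v : List α} {q s : List β} (hq : q <+: φ B) (hs : s <+: φ D) (hq0 : q ≠ []) (hs0 : s ≠ [])
    (e : u.flatMap φ ++ q = v.flatMap φ ++ s) : u = v ∧ q = s := by
  have aux : ∀ {B b : α} {v : List α} {q s : List β}, q <+: φ B → s ≠ [] →
      q ≠ φ b ++ (v.flatMap φ ++ s) := by
    rintro B b v q s hq hs0 rfl
    obtain rfl := h.eq_of_prefix (hφ b) ((List.prefix_append _ _).trans hq)
    have := hq.length_le
    have := List.length_pos_iff.2 hs0
    simp only [List.length_append] at *
    omega
  induction u generalizing v with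
  | nil =>
    cases v with
    | nil => simpa using e
    | cons b v => exact (aux hq hs0 (by simpa using e)).elim
  | cons a u ih =>
    cases v with
    | nil => exact (aux hs hq0 (by simpa using e.symm)).elim
    | cons b v =>
      obtain rfl : a = b := by
        simp only [List.flatMap_cons, List.append_assoc] at e
        rcases List.prefix_or_prefix_of_prefix (l₁ := φ a) (l₂ := φ b) ⟨_, e⟩ ⟨_, rfl⟩ with h' | h'
        · exact h.eq_of_prefix (hφ _) h'
        · exact (h.eq_of_prefix (hφ _) h').symm
      have := ih (v := v) (by simpa using e)
      simpa using this

theorem eq_of_append_flatMap_eq (h : SquareFreeOnTriples φ) (hφ : ∀ a, φ a ≠ []) {A C : α}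
    {u v : List α} {p r : List β} (hp : p <:+ φ A) (hr : r <:+ φ C) (hp0 : p ≠ [])
    (e : p ++ u.flatMap φ = r ++ v.flatMap φ) :
    (u = v ∧ p = r) ∨ (v = A :: u ∧ r = []) := by
  have aux : ∀ {A b : α} {v : List α} {p r : List β}, p <:+ φ A →
      p = r ++ (v.flatMap φ ++ φ b) → b = A ∧ v = [] ∧ r = [] := by
    rintro A b v p r hp rfl
    obtain rfl := h.eq_of_suffix (hφ b) (List.IsSuffix.trans ⟨r ++ v.flatMap φ, by simp⟩ hp)
    have := hp.length_le
    simp only [List.length_append] at this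
    have h₁ : r = [] := List.length_eq_zero_iff.1 (by omega)
    have h₂ : v.flatMap φ = [] := List.length_eq_zero_iff.1 (by omega)
    refine ⟨rfl, ?_, h₁⟩
    cases v with
    | nil => rfl
    | cons a v => simp [hφ] at h₂
  induction u using List.reverseRecOn generalizing v with
  | nil =>
    rcases List.eq_nil_or_concat' v with rfl | ⟨v, b, rfl⟩
    · simpa using e
    · obtain ⟨rfl, rfl, rfl⟩ := aux (b := b) (v := v) (r := r) hp (by simpa using e)
      simp
  | append_singleton u a ih =>
    rcases List.eq_nil_or_concat' v with rfl | ⟨v, b, rfl⟩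
    · exact (hp0 (aux (b := a) (v := u) (r := p) hr (by simpa using e.symm)).2.2).elim
    · obtain rfl : a = b := by
        simp only [List.flatMap_append, List.flatMap_singleton, ← List.append_assoc] at e
        rcases List.suffix_or_suffix_of_suffix (l₁ := φ a) (l₂ := φ b) ⟨_, e⟩ ⟨_, rfl⟩ with h' | h'
        · exact h.eq_of_suffix (hφ _) h'
        · exact (h.eq_of_suffix (hφ _) h').symm
      rcases ih (v := v) (by simpa [← List.append_assoc] using e) with ⟨rfl, rfl⟩ | ⟨rfl, rfl⟩ <;>
        simp

/-- No square spreads over the image of a squarefree word with its centre in the image of an inner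
letter. -/
theorem false_of_inner_centre (h : SquareFreeOnTriples φ) (hφ : ∀ a, φ a ≠ []) {A B D : α}
    {u v : List α} (hw : SquareFree' (A :: (u ++ B :: (v ++ [D]))))
    (huv : 0 < u.length + v.length) {p q r s : List β} (hp : p <:+ φ A) (hqr : q ++ r = φ B)
    (hs : s <+: φ D) (hp0 : p ≠ []) (hq0 : q ≠ []) (hs0 : s ≠ [])
    (e : p ++ (u.flatMap φ ++ q) = r ++ (v.flatMap φ ++ s)) : False := by
  have hq : q <+: φ B := ⟨r, hqr⟩
  have hr : r <:+ φ B := ⟨q, hqr⟩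
  obtain ⟨u₁, u₂, v₁, v₂, rfl, rfl, h₁, h₂⟩ := h.exists_common_cut
    (hw.of_infix ⟨[], v ++ [D], by simp⟩).isChain_ne
    (hw.of_infix ⟨A :: u, [], by simp⟩).isChain_ne hp hq hr hs huv e
  obtain ⟨rfl, rfl⟩ := h.eq_of_flatMap_append_eq hφ hq hs hq0 hs0 h₂
  rcases h.eq_of_append_flatMap_eq hφ hp hr hp0 h₁ with ⟨rfl, rfl⟩ | ⟨rfl, rfl⟩
  · have hAB : A ≠ B := by
      rintro rfl
      simpa using hw.eq_nil_of_append (X := A :: (u₁ ++ u₂)) [] [D] (by simp)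
    have hBD : B ≠ D := by
      rintro rfl
      simpa using hw.eq_nil_of_append (X := u₁ ++ u₂ ++ [B]) [A] [] (by simp)
    obtain ⟨a, ha⟩ := hp
    obtain ⟨b, hb⟩ := hs
    have := (h A B D hAB hBD).eq_nil_of_append (X := p ++ q) a b (by simp [← ha, ← hb, ← hqr])
    simp_all
  · obtain rfl : B = D := h.eq_of_prefix (hφ B) (by simpa [← hqr] using hs)
    simpa using hw.eq_nil_of_append (X := A :: (u₁ ++ (u₂ ++ [B]))) [] [] (by simp)

end SquareFreeOnTriples

theorem List.exists_of_flatMap_eq_append {α β : Type*} {φ : α → List β} {m : List α}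
    {x y : List β} (hx : x ≠ []) (e : m.flatMap φ = x ++ y) :
    ∃ u c v q r, m = u ++ c :: v ∧ q ++ r = φ c ∧ q ≠ [] ∧ x = u.flatMap φ ++ q ∧
      y = r ++ v.flatMap φ := by
  induction m generalizing x with
  | nil => simp_all
  | cons a m ih =>
    rw [List.flatMap_cons] at e
    rcases List.append_eq_append_iff.1 e with ⟨t, rfl, ht⟩ | ⟨t, ht, rfl⟩
    · by_cases h0 : t = []
      · subst h0
        exact ⟨[], a, m, φ a, [], by simp, by simp, by simpa using hx, by simp,
          by simpa using ht.symm⟩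
      · obtain ⟨u, c, v, q, r, rfl, h₁, h₂, rfl, rfl⟩ := ih h0 ht
        exact ⟨a :: u, c, v, q, r, by simp, h₁, h₂, by simp, rfl⟩
    · exact ⟨[], a, m, x, t, by simp, ht.symm, hx, by simp, rfl⟩

theorem SquareFree'.length_le_three {m : List (Fin 3)} {c : Fin 3} (hm : SquareFree' m)
    (hc : c ∉ m) : m.length ≤ 3 := by
  match m, hm, hc with
  | [], _, _ => simp
  | [_], _, _ => simp
  | [_, _], _, _ => simp
  | [_, _, _], _, _ => simp
  | x₁ :: x₂ :: x₃ :: x₄ :: t, hm, hc =>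
    have hch := hm.isChain_ne
    simp only [List.isChain_cons_cons] at hch
    simp only [List.mem_cons, not_or] at hc
    obtain rfl : x₃ = x₁ := by omega
    obtain rfl : x₄ = x₂ := by omega
    simpa using hm.eq_nil_of_append (X := [x₃, x₄]) [] t (by simp)

theorem SquareFree'.length_le_three_of_flatMap_infix {β : Type*} {φ : Fin 3 → List β}
    (hφ : ∀ a, φ a ≠ []) {m : List (Fin 3)} {c : Fin 3} (hm : SquareFree' m)
    (h : m.flatMap φ <:+: φ c) : m.length ≤ 3 := by
  by_cases hc : c ∈ m
  · obtain ⟨u, v, rfl⟩ := List.append_of_mem hc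
    have hl := h.length_le
    simp only [List.flatMap_append, List.flatMap_cons, List.length_append] at hl
    have hnil : ∀ l : List (Fin 3), (l.flatMap φ).length = 0 → l = [] := by
      intro l hl
      cases l with
      | nil => rfl
      | cons a l => simp [hφ] at hl
    rw [hnil u (by omega), hnil v (by omega)]
    simp
  · exact hm.length_le_three hc

theorem SquareFree'.exists_append_singleton {u : List (Fin 3)} (hu : SquareFree' u)
    (hl : u.length ≤ 4) : ∃ e, SquareFree' (u ++ [e]) := by
  obtain ⟨e, he⟩ : ∃ e : Fin 3, (∀ t x, u = t ++ [x] → e ≠ x) ∧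
      (∀ t x y, u = t ++ [x, y] → e ≠ x) := by
    have key : ∀ a b : Fin 3, ∃ e, e ≠ a ∧ e ≠ b := by decide
    rcases List.eq_nil_or_concat' u with rfl | ⟨u, b, rfl⟩
    · simp
    rcases List.eq_nil_or_concat' u with rfl | ⟨u, a, rfl⟩
    · obtain ⟨e, he, -⟩ := key b b
      refine ⟨e, ?_, ?_⟩
      · intro t x h
        have := List.append_inj_right' h rfl
        simp_all
      · intro t x y h
        have := congrArg List.length h
        simp at this
    · obtain ⟨e, he, he'⟩ := key a b
      refine ⟨e, ?_, ?_⟩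
      · intro t x h
        have := List.append_inj_right' h rfl
        simp_all
      · intro t x y h
        have := List.append_inj_right' (s₁ := u) (t₁ := [a, b]) (s₂ := t) (t₂ := [x, y])
          (by simpa using h) rfl
        simp_all
  refine ⟨e, ?_⟩
  rintro ⟨w, ⟨a, b, hab⟩, X, hX, rfl⟩
  rcases List.eq_nil_or_concat' b with rfl | ⟨b, z, rfl⟩
  · have hlen := congrArg List.length hab
    simp at hlen
    match X, hX with
    | [x], _ =>
      have h' : (a ++ [x]) ++ [x] = u ++ [e] := by simpa using hab
      obtain ⟨h₁, h₂⟩ := List.append_inj' h' rfl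
      exact he.1 a x h₁.symm (by simp_all)
    | [x, y], _ =>
      have h' : (a ++ [x] ++ [y, x]) ++ [y] = u ++ [e] := by simpa using hab
      obtain ⟨h₁, h₂⟩ := List.append_inj' h' rfl
      exact he.2 (a ++ [x]) y x h₁.symm (by simp_all)
    | x :: y :: z :: X, _ =>
      simp at hlen
      omega
  · have h' : (a ++ (X ++ X) ++ b) ++ [z] = u ++ [e] := by simpa using hab
    obtain ⟨h₁, -⟩ := List.append_inj' h' rfl
    exact hX (hu.eq_nil_of_append a b (by simp [← h₁]))

theorem SquareFree'.exists_append_length_eq_five {u : List (Fin 3)} (hu : SquareFree' u)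
    (hl : u.length ≤ 5) : ∃ t, (u ++ t).length = 5 ∧ SquareFree' (u ++ t) := by
  induction hn : 5 - u.length generalizing u with
  | zero => exact ⟨[], by simp; omega, by simpa using hu⟩
  | succ n ih =>
    obtain ⟨e, he⟩ := hu.exists_append_singleton (by omega)
    obtain ⟨t, h₁, h₂⟩ := ih he (by simp; omega) (by simp; omega)
    exact ⟨e :: t, by simpa using h₁, by simpa using h₂⟩

theorem squareFree'_triple {α : Type*} {a b c : α} (hab : a ≠ b) (hbc : b ≠ c) :
    SquareFree' [a, b, c] := by
  rintro ⟨w, ⟨s, t, h⟩, X, hX, rfl⟩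
  have hlen := congrArg List.length h
  simp at hlen
  match X, hX with
  | [x], _ =>
    match s with
    | [] => simp at h; grind
    | [y] => simp at h; grind
    | y :: z :: s => simp at hlen; omega
  | x :: y :: X, _ => simp at hlen; omega

theorem squareFree'_flatMap_of_length_five {β : Type*} {φ : Fin 3 → List β}
    (h5 : ∀ u : List (Fin 3), u.length = 5 → SquareFree' u → SquareFree' (u.flatMap φ))
    (w : List (Fin 3)) (hw : SquareFree' w) : SquareFree' (w.flatMap φ) := by
  have hle : ∀ u : List (Fin 3), u.length ≤ 5 → SquareFree' u → SquareFree' (u.flatMap φ) := by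
    intro u hl hu
    obtain ⟨t, h₁, h₂⟩ := hu.exists_append_length_eq_five hl
    exact (h5 _ h₁ h₂).of_infix ⟨[], t.flatMap φ, by simp⟩
  have h : SquareFreeOnTriples φ := fun a b c hab hbc => by
    simpa using hle [a, b, c] (by simp) (squareFree'_triple hab hbc)
  by_cases hφ : ∀ a, φ a ≠ []
  swap
  · push Not at hφ
    obtain ⟨x, hx⟩ := hφ
    have hall : ∀ y, φ y = [] := by
      intro y
      by_cases hxy : y = x
      · rwa [hxy]
      · exact (h y x y hxy (Ne.symm hxy)).eq_nil_of_append [] [] (by simp [hx])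
    have : w.flatMap φ = [] := by simp [hall]
    rw [this]
    rintro ⟨v, hv, X, hX, rfl⟩
    simp_all
  induction hn : w.length using Nat.strong_induction_on generalizing w with
  | _ n ih =>
  by_cases hl : w.length ≤ 5
  · exact hle w hl hw
  obtain ⟨A, m, D, rfl⟩ : ∃ A m D, w = A :: (m ++ [D]) := by
    cases w with
    | nil => simp at hl
    | cons A w =>
      rcases List.eq_nil_or_concat' w with rfl | ⟨m, D, rfl⟩
      · simp at hl
      · exact ⟨A, m, D, by simp⟩
  have hm4 : 4 ≤ m.length := by simp at hl; omega
  have hm : SquareFree' m := hw.of_infix ⟨[A], [D], by simp⟩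
  have hnot : ∀ c, ¬ m.flatMap φ <:+: φ c := fun c hc => by
    have := hm.length_le_three_of_flatMap_infix hφ hc
    omega
  have hleft : SquareFree' ((A :: m).flatMap φ) :=
    ih _ (by simp at hn ⊢; omega) _ (hw.of_infix ⟨[], [D], by simp⟩) rfl
  have hright : SquareFree' ((m ++ [D]).flatMap φ) :=
    ih _ (by simp at hn ⊢; omega) _ (hw.of_infix ⟨[A], [], by simp⟩) rfl
  rintro ⟨_, ⟨p, s, e⟩, X, hX, rfl⟩
  simp only [List.flatMap_cons, List.flatMap_append, List.flatMap_nil, List.append_nil,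
    List.append_assoc] at e hleft hright
  obtain ⟨p', hp', hp0, e₁⟩ : ∃ p', p ++ p' = φ A ∧ p' ≠ [] ∧
      X ++ (X ++ s) = p' ++ (m.flatMap φ ++ φ D) := by
    rcases List.append_eq_append_iff.1 e with ⟨t, ht, h'⟩ | ⟨t, rfl, h'⟩
    · by_cases h0 : t = []
      · subst h0
        exact (hX (hright.eq_nil_of_append [] s (by simpa using h'.symm))).elim
      · exact ⟨t, ht.symm, h0, h'⟩
    · exact (hX (hright.eq_nil_of_append t s h')).elim
  obtain ⟨s', hs', hs0, e₂⟩ : ∃ s', s' ++ s = φ D ∧ s' ≠ [] ∧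
      X ++ X = p' ++ (m.flatMap φ ++ s') := by
    have e₁' : (X ++ X) ++ s = (p' ++ m.flatMap φ) ++ φ D := by simpa using e₁
    rcases List.append_eq_append_iff.1 e₁' with ⟨t, ht, h'⟩ | ⟨t, ht, h'⟩
    · refine (hX (hleft.eq_nil_of_append p t ?_)).elim
      rw [← hp', List.append_assoc, ht]
      simp
    · by_cases h0 : t = []
      · subst h0
        refine (hX (hleft.eq_nil_of_append p [] ?_)).elim
        rw [← hp', List.append_assoc, ← List.append_nil (p' ++ _), ← List.append_nil (_ ++ []), ← ht]
        simp
      · exact ⟨t, h'.symm, h0, by simpa using ht⟩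
  rcases List.append_eq_append_iff.1 e₂ with ⟨t, rfl, h'⟩ | ⟨x, rfl, h'⟩
  · refine hnot A ⟨p ++ t, s' ++ t, ?_⟩
    subst h'
    simpa using hp'
  · by_cases hx : x = []
    · subst hx
      exact hnot A ⟨p, s', by simpa [← hp'] using h'⟩
    rcases List.append_eq_append_iff.1 h' with ⟨t, rfl, h''⟩ | ⟨y, h'', h₃⟩
    · exact hnot D ⟨t ++ p', t ++ s, by simp [← hs', h'']⟩
    · obtain ⟨u, B, v, q, r, rfl, hqr, hq0, rfl, rfl⟩ := List.exists_of_flatMap_eq_append hx h''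
      refine h.false_of_inner_centre hφ (A := A) (B := B) (D := D) (u := u) (v := v)
        (by simpa using hw) (by simp at hm4; omega) ⟨p, hp'⟩ hqr ⟨s, hs'⟩ hp0 hq0 hs0
        (by simpa using h₃)

theorem crochemore (f : FreeMonoid (Fin 3) →* FreeMonoid (Fin 3)) :
    (∀ w : List (Fin 3), SquareFree' w →
        SquareFree' (FreeMonoid.toList (f (FreeMonoid.ofList w)))) ↔
    (∀ u : List (Fin 3), u.length = 5 → SquareFree' u →
        SquareFree' (FreeMonoid.toList (f (FreeMonoid.ofList u)))) := by
  refine ⟨fun h u _ hu => h u hu, fun h5 => ?_⟩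
  have hf : ∀ w : List (Fin 3), FreeMonoid.toList (f (FreeMonoid.ofList w)) =
      w.flatMap fun a => FreeMonoid.toList (f (FreeMonoid.of a)) := by
    intro w
    induction w with
    | nil => simp
    | cons a w ih => simp [FreeMonoid.ofList_cons, ih]
  simp only [hf] at h5 ⊢
  exact squareFree'_flatMap_of_length_five h5
end

section
/- If w = w′w′′ is an overlap-free binary word with |w′| ≥ 5 and |w′′| ≥ 5, then for every letter a ∈ {0,1} the word w′ a w′′ contains an overlap. -/
/-- An overlap is a word of the form xYxYx where x is a letter and Y is a
possibly empty word. -/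
def IsOverlap {α : Type*} (w : List α) : Prop :=
  ∃ (x : α) (Y : List α), w = [x] ++ Y ++ [x] ++ Y ++ [x]

/-- A word contains an overlap if some factor (contiguous subword) of it is an overlap. -/
def HasOverlap {α : Type*} (w : List α) : Prop :=
  ∃ u, u <:+: w ∧ IsOverlap u

/-- A word is overlap-free if none of its factors is an overlap. -/
def OverlapFree {α : Type*} (w : List α) : Prop := ¬ HasOverlap w

/-- A Boolean test for overlaps: some suffix `x :: s` of the word has a prefix of the form xYxYx,
where `Y` is a prefix of `s`. -/
def overlapTest {α : Type*} [DecidableEq α] : List α → Bool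
  | [] => false
  | x :: s =>
    (s.inits.any fun Y => ((x :: Y) ++ (x :: Y) ++ [x]).isPrefixOf (x :: s)) || overlapTest s

theorem HasOverlap.mono {α : Type*} {v w : List α} (h : HasOverlap v) (hvw : v <:+: w) :
    HasOverlap w := by
  obtain ⟨u, hu, ho⟩ := h
  exact ⟨u, hu.trans hvw, ho⟩

theorem hasOverlap_of_overlapTest {α : Type*} [DecidableEq α] {w : List α}
    (h : overlapTest w = true) : HasOverlap w := by
  induction w with
  | nil => simp [overlapTest] at h
  | cons x s ih =>
    rw [overlapTest, Bool.or_eq_true, List.any_eq_true] at h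
    rcases h with ⟨Y, -, hY⟩ | h
    · exact ⟨_, (List.isPrefixOf_iff_prefix.mp hY).isInfix, x, Y, by simp⟩
    · exact (ih h).mono (List.suffix_cons x s).isInfix

/-- The theorem for words of length ten cut in the middle, verified by enumeration. -/
theorem overlapTest_or_overlapTest_insert :
    ∀ b₁ b₂ b₃ b₄ b₅ c₁ c₂ c₃ c₄ c₅ a : Fin 2,
      overlapTest [b₁, b₂, b₃, b₄, b₅, c₁, c₂, c₃, c₄, c₅] = true ∨
        overlapTest [b₁, b₂, b₃, b₄, b₅, a, c₁, c₂, c₃, c₄, c₅] = true := by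
  decide +kernel

theorem List.exists_eq_of_length_eq_five {α : Type*} {l : List α} (h : l.length = 5) :
    ∃ a b c d e, l = [a, b, c, d, e] := by
  match l, h with
  | [a, b, c, d, e], _ => exact ⟨a, b, c, d, e, rfl⟩

theorem extension_contains_overlap (w' w'' : List (Fin 2))
    (hfree : OverlapFree (w' ++ w''))
    (h' : 5 ≤ w'.length) (h'' : 5 ≤ w''.length) (a : Fin 2) :
    HasOverlap (w' ++ a :: w'') := by
  obtain ⟨b₁, b₂, b₃, b₄, b₅, hb⟩ := List.exists_eq_of_length_eq_five
    (l := w'.drop (w'.length - 5)) (by rw [List.length_drop]; omega)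
  obtain ⟨c₁, c₂, c₃, c₄, c₅, hc⟩ := List.exists_eq_of_length_eq_five
    (l := w''.take 5) (by rw [List.length_take]; omega)
  rw [← List.take_append_drop (w'.length - 5) w', ← List.take_append_drop 5 w'', hb, hc]
    at hfree ⊢
  rcases overlapTest_or_overlapTest_insert b₁ b₂ b₃ b₄ b₅ c₁ c₂ c₃ c₄ c₅ a with h | h
  · exact absurd ((hasOverlap_of_overlapTest h).mono
      ⟨w'.take (w'.length - 5), w''.drop 5, by simp⟩) hfree
  · exact (hasOverlap_of_overlapTest h).mono
      ⟨w'.take (w'.length - 5), w''.drop 5, by simp⟩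
end

section
/- Let w₀ = 01100110100110010110011010011001 and w₍ᵢ₊₁₎ = μ(wᵢ), where μ is the binary morphism with μ(0)=01 and μ(1)=10. Then for every i ≥ 0, the word wᵢ is an overlap-free binary word that is simultaneously extremal, irreducible, and delicate. -/
/-- An extremal overlap-free binary word: an overlap-free word over {0,1} such that
inserting any letter at any position (including the ends) creates an overlap. -/
def ExtremalOverlapFree (w : List (Fin 2)) : Prop :=
  OverlapFree w ∧
    ∀ u v : List (Fin 2), w = u ++ v → ∀ a : Fin 2, HasOverlap (u ++ a :: v)

/-- An irreducible overlap-free word: an overlap-free word of length at least 3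
such that removing any one interior letter creates an overlap. -/
def IrreducibleOverlapFree (w : List (Fin 2)) : Prop :=
  OverlapFree w ∧ 3 ≤ w.length ∧
    ∀ i : ℕ, 0 < i → i + 1 < w.length → HasOverlap (w.eraseIdx i)

/-- A delicate overlap-free binary word: a nonempty overlap-free word over {0,1}
such that changing any one of its letters to the other letter creates an overlap. -/
def DelicateOverlapFree (w : List (Fin 2)) : Prop :=
  w ≠ [] ∧ OverlapFree w ∧
    ∀ (i : ℕ) (h : i < w.length) (a : Fin 2), a ≠ w.get ⟨i, h⟩ → HasOverlap (w.set i a)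

/-- The binary morphism μ with μ(0)=01 and μ(1)=10. -/
def mu : Fin 2 → List (Fin 2) := fun a => if a = 0 then [0,1] else [1,0]

/-- The sequence w₀ = 01100110100110010110011010011001, wᵢ₊₁ = μ(wᵢ). -/
def wSeq : ℕ → List (Fin 2)
  | 0 => [0,1,1,0,0,1,1,0,1,0,0,1,1,0,0,1,0,1,1,0,0,1,1,0,1,0,0,1,1,0,0,1]
  | i + 1 => applyMorphism mu (wSeq i)

/-- The run of length `2 * p + 1` of `w` starting at position `s` has period `p`. -/
def OverlapAt {α : Type*} (w : List α) (s p : ℕ) : Prop :=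
  0 < p ∧ s + 2 * p < w.length ∧ ∀ t < p + 1, w[s + t]? = w[s + t + p]?

theorem OverlapAt.hasOverlap {α : Type*} {w : List α} {s p : ℕ} (h : OverlapAt w s p) :
    HasOverlap w := by
  obtain ⟨hp, hlen, hper⟩ := h
  refine ⟨(w.drop s).take (2 * p + 1),
    (List.take_prefix _ _).isInfix.trans (List.drop_suffix _ _).isInfix,
    w[s], (w.drop (s + 1)).take (p - 1), ?_⟩
  apply List.ext_getElem
  · simp only [List.length_append, List.length_take, List.length_drop, List.length_singleton]
    omega
  · intro n h₁ h₂
    have hn : n < 2 * p + 1 := by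
      simp only [List.length_take, List.length_drop] at h₁
      omega
    have same : ∀ i j (hi : i < w.length) (hj : j < w.length), i = j → w[i] = w[j] := by
      rintro i _ hi hj rfl
      rfl
    have shift : ∀ i j (hi : i < w.length) (hj : j < w.length), s ≤ j → j ≤ s + p → i = j + p →
        w[i] = w[j] := by
      rintro _ j hi hj hsj hjp rfl
      have := hper (j - s) (by omega)
      rw [show s + (j - s) = j by omega] at this
      simpa [hi, hj] using this.symm
    have hY : ((w.drop (s + 1)).take (p - 1)).length = p - 1 := by
      simp only [List.length_take, List.length_drop]
      omega
    simp only [List.getElem_append, List.getElem_take, List.getElem_drop, List.getElem_singleton,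
      List.length_append, List.length_singleton, hY]
    split_ifs
    · exact same _ _ _ _ (by omega)
    · exact same _ _ _ _ (by omega)
    · exact shift _ _ _ _ (by omega) (by omega) (by omega)
    · exact shift _ _ _ _ (by omega) (by omega) (by omega)
    · exact (shift _ (s + p) _ (by omega) (by omega) (by omega) (by omega)).trans
        (shift _ _ _ _ (by omega) (by omega) (by omega))

theorem hasOverlap_iff {α : Type*} {w : List α} :
    HasOverlap w ↔ ∃ s < w.length, ∃ p < w.length, OverlapAt w s p := by
  constructor
  · rintro ⟨_, ⟨A, B, rfl⟩, x, Y, rfl⟩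
    refine ⟨A.length, ?_, Y.length + 1, ?_, ?_, ?_, ?_⟩
    · simp
    · simp; omega
    · omega
    · simp; omega
    · intro t ht
      have ht' : t < ([x] ++ Y ++ [x]).length := by simp; omega
      have middle : ∀ P Z S : List α, t < Z.length → (P ++ (Z ++ S))[P.length + t]? = Z[t]? := by
        intro P Z S hZ
        rw [List.getElem?_append_right (by omega), Nat.add_sub_cancel_left,
          List.getElem?_append_left hZ]
      calc _ = (A ++ (([x] ++ Y ++ [x]) ++ (Y ++ [x] ++ B)))[A.length + t]? := by simp
        _ = ((A ++ [x] ++ Y) ++ (([x] ++ Y ++ [x]) ++ B))[(A ++ [x] ++ Y).length + t]? := by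
          rw [middle _ _ _ ht', middle _ _ _ ht']
        _ = _ := by
          congr 1
          · simp
          · simp; omega
  · rintro ⟨s, -, p, -, h⟩
    exact h.hasOverlap

/-- Both words have at least `n` letters, and their first `n` letters agree. -/
def agree {α : Type*} [DecidableEq α] : ℕ → List α → List α → Bool
  | 0, _, _ => true
  | n + 1, a :: u, b :: v => decide (a = b) && agree n u v
  | _ + 1, _, _ => false

/-- Some suffix of `v` obtained by dropping `k` letters agrees with `u` on the first `n + k`
letters. -/
def agreeSuffix {α : Type*} [DecidableEq α] (u : List α) : ℕ → List α → Bool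
  | _, [] => false
  | n, b :: v => agree n u (b :: v) || agreeSuffix u (n + 1) v

/-- A decision procedure for containing an overlap. -/
def findOverlap {α : Type*} [DecidableEq α] : List α → Bool
  | [] => false
  | a :: w => agreeSuffix (a :: w) 2 w || findOverlap w

theorem agree_iff {α : Type*} [DecidableEq α] (n : ℕ) (u v : List α) :
    agree n u v = true ↔ n ≤ u.length ∧ n ≤ v.length ∧ ∀ t < n, u[t]? = v[t]? := by
  induction n generalizing u v with
  | zero => simp [agree]
  | succ n ih =>
    match u, v with
    | [], _ => simp [agree]
    | _ :: _, [] => simp [agree]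
    | a :: u, b :: v =>
      simp only [agree, Bool.and_eq_true, decide_eq_true_eq, ih, List.length_cons,
        Nat.add_le_add_iff_right, Nat.forall_lt_succ_left, List.getElem?_cons_zero,
        List.getElem?_cons_succ, Option.some.injEq]
      tauto

theorem agreeSuffix_iff {α : Type*} [DecidableEq α] (u : List α) (n : ℕ) (v : List α) :
    agreeSuffix u n v = true ↔ ∃ k < v.length, agree (n + k) u (v.drop k) = true := by
  induction v generalizing n with
  | nil => simp [agreeSuffix]
  | cons b v ih =>
    simp only [agreeSuffix, Bool.or_eq_true, ih, List.length_cons, Nat.exists_lt_succ_left,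
      List.drop_zero, List.drop_succ_cons, add_zero, add_assoc, add_comm 1]

theorem findOverlap_iff {α : Type*} [DecidableEq α] (w : List α) :
    findOverlap w = true ↔
      ∃ s < w.length, agreeSuffix (w.drop s) 2 (w.drop (s + 1)) = true := by
  induction w with
  | nil => simp [findOverlap]
  | cons a w ih =>
    simp only [findOverlap, Bool.or_eq_true, ih, List.length_cons, Nat.exists_lt_succ_left,
      List.drop_zero, List.drop_succ_cons]

theorem findOverlap_iff_hasOverlap {α : Type*} [DecidableEq α] {w : List α} :
    findOverlap w = true ↔ HasOverlap w := by
  simp only [findOverlap_iff, agreeSuffix_iff, agree_iff, hasOverlap_iff, OverlapAt,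
    List.length_drop, List.getElem?_drop, List.drop_drop]
  constructor
  · rintro ⟨s, hs, k, hk, h₁, h₂, h⟩
    refine ⟨s, hs, k + 1, by omega, by omega, by omega, fun t ht => ?_⟩
    rw [h t (by omega)]
    congr 1
    omega
  · rintro ⟨s, hs, p, hp, hp0, hlen, h⟩
    refine ⟨s, hs, p - 1, by omega, by omega, by omega, fun t ht => ?_⟩
    rw [h t (by omega)]
    congr 1
    omega

instance {α : Type*} [DecidableEq α] (w : List α) : Decidable (HasOverlap w) :=
  decidable_of_iff _ findOverlap_iff_hasOverlap

theorem HasOverlap.append_append {α : Type*} {v : List α} (h : HasOverlap v) (p s : List α) :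
    HasOverlap (p ++ (v ++ s)) :=
  h.mono ⟨p, s, by simp⟩

theorem mu_eq (a : Fin 2) : mu a = [a, 1 - a] := by
  revert a; decide

/-- The word obtained by applying the morphism `mu` once. -/
abbrev muWord (w : List (Fin 2)) : List (Fin 2) := applyMorphism mu w

theorem muWord_cons (a : Fin 2) (w : List (Fin 2)) :
    muWord (a :: w) = a :: (1 - a) :: muWord w := by
  simp [applyMorphism, mu_eq]

theorem length_muWord (w : List (Fin 2)) : (muWord w).length = 2 * w.length := by
  induction w with
  | nil => rfl
  | cons a w ih => rw [muWord_cons]; simp only [List.length_cons, ih]; omega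

theorem getElem?_muWord_even (w : List (Fin 2)) (j : ℕ) : (muWord w)[2 * j]? = w[j]? := by
  induction w generalizing j with
  | nil => simp [applyMorphism]
  | cons a w ih =>
    rw [muWord_cons]
    cases j with
    | zero => rfl
    | succ j => simpa [Nat.mul_succ] using ih j

theorem getElem?_muWord_odd (w : List (Fin 2)) (j : ℕ) :
    (muWord w)[2 * j + 1]? = w[j]?.map (1 - ·) := by
  induction w generalizing j with
  | nil => simp [applyMorphism]
  | cons a w ih =>
    rw [muWord_cons]
    cases j with
    | zero => simp
    | succ j => simpa [Nat.mul_succ] using ih j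

theorem one_sub_injective : Function.Injective (fun a : Fin 2 => 1 - a) := by decide

theorem OverlapAt.of_muWord_even {w : List (Fin 2)} {s q : ℕ}
    (h : OverlapAt (muWord w) s (2 * q)) : OverlapAt w (s / 2) q := by
  obtain ⟨hp, hlen, hper⟩ := h
  rw [length_muWord] at hlen
  refine ⟨by omega, by omega, fun t ht => ?_⟩
  have := hper (2 * t) (by omega)
  rcases Nat.even_or_odd' s with ⟨r, rfl | rfl⟩
  · rw [show 2 * r + 2 * t = 2 * (r + t) by ring,
      show 2 * (r + t) + 2 * q = 2 * (r + t + q) by ring,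
      getElem?_muWord_even, getElem?_muWord_even] at this
    rwa [show 2 * r / 2 = r by omega]
  · rw [show 2 * r + 1 + 2 * t = 2 * (r + t) + 1 by ring,
      show 2 * (r + t) + 1 + 2 * q = 2 * (r + t + q) + 1 by ring,
      getElem?_muWord_odd, getElem?_muWord_odd] at this
    rw [show (2 * r + 1) / 2 = r by omega]
    exact Option.map_injective one_sub_injective this

theorem not_overlapAt_muWord_odd {w : List (Fin 2)} {s q : ℕ} :
    ¬ OverlapAt (muWord w) s (2 * q + 1) := by
  rintro ⟨-, hlen, hper⟩
  have aligned : ∀ j, 2 * j + 1 < (muWord w).length →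
      (muWord w)[2 * j + 1]? = (muWord w)[2 * j]?.map (1 - ·) := by
    intro j _
    rw [getElem?_muWord_even, getElem?_muWord_odd]
  have invol : ∀ o : Option (Fin 2), (o.map (1 - ·)).map (1 - ·) = o := by decide
  have step : ∀ t < 2 * q + 1,
      (muWord w)[s + (t + 1)]? = (muWord w)[s + t]?.map (1 - ·) := by
    intro t ht
    rcases Nat.even_or_odd' (s + t) with ⟨r, hr | hr⟩
    · have := aligned r (by omega)
      rwa [← hr, add_assoc] at this
    · have := aligned (r + q + 1) (by omega)
      rw [hper t (by omega), hper (t + 1) (by omega)]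
      rwa [show 2 * (r + q + 1) + 1 = s + (t + 1) + (2 * q + 1) by omega,
        show 2 * (r + q + 1) = s + t + (2 * q + 1) by omega] at this
  have alternate : ∀ r ≤ q, (muWord w)[s + 2 * r]? = (muWord w)[s]? := by
    intro r
    induction r with
    | zero => simp
    | succ r ih =>
      intro hr
      rw [show s + 2 * (r + 1) = s + (2 * r + 1 + 1) by ring, step _ (by omega),
        step _ (by omega), invol, ih (by omega)]
  have h₁ := step (2 * q) (by omega)
  rw [alternate q le_rfl] at h₁
  have h₂ := hper 0 (by omega)
  rw [add_zero, h₁, List.getElem?_eq_getElem (by omega)] at h₂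
  have ne : ∀ a : Fin 2, some a ≠ (some a).map (1 - ·) := by decide
  exact ne _ h₂

/-- Thue: the morphism `mu` preserves overlap-freeness. -/
theorem OverlapFree.muWord {w : List (Fin 2)} (h : OverlapFree w) :
    OverlapFree (muWord w) := by
  intro hw
  obtain ⟨s, -, p, -, hsp⟩ := hasOverlap_iff.1 hw
  rcases Nat.even_or_odd' p with ⟨q, rfl | rfl⟩
  · exact h hsp.of_muWord_even.hasOverlap
  · exact not_overlapAt_muWord_odd hsp

theorem HasOverlap.muWord {w : List (Fin 2)} (h : HasOverlap w) : HasOverlap (muWord w) := by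
  obtain ⟨_, ⟨A, B, rfl⟩, x, Y, rfl⟩ := h
  refine ⟨_, ⟨_root_.muWord A, (1 - x) :: _root_.muWord B, ?_⟩,
    x, (1 - x) :: _root_.muWord Y, rfl⟩
  simp [applyMorphism, mu_eq]

theorem HasOverlap.cons_muWord {a : Fin 2} {w : List (Fin 2)} (h : HasOverlap ((1 - a) :: w)) :
    HasOverlap (a :: _root_.muWord w) := by
  obtain ⟨_, ⟨A, B, hw⟩, x, Y, rfl⟩ := h
  cases A with
  | nil =>
    simp only [List.nil_append, List.cons_append, List.cons.injEq, List.append_assoc] at hw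
    obtain ⟨rfl, rfl⟩ := hw
    refine ⟨_, ⟨[], _root_.muWord B, ?_⟩, a, _root_.muWord Y ++ [1 - a], rfl⟩
    simp [applyMorphism, mu_eq]
  | cons c A =>
    simp only [List.cons_append, List.cons.injEq] at hw
    have : HasOverlap w := ⟨_, ⟨A, B, hw.2⟩, x, Y, rfl⟩
    exact this.muWord.mono (List.suffix_cons _ _).isInfix

theorem HasOverlap.muWord_concat {a : Fin 2} {w : List (Fin 2)} (h : HasOverlap (w ++ [a])) :
    HasOverlap (_root_.muWord w ++ [a]) := by
  obtain ⟨_, ⟨A, B, hw⟩, x, Y, rfl⟩ := h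
  rcases List.eq_nil_or_concat' B with rfl | ⟨B, c, rfl⟩
  · rw [List.append_nil, ← List.append_assoc] at hw
    obtain ⟨rfl, hx⟩ := List.append_inj' hw rfl
    obtain rfl : x = a := by simpa using hx
    refine ⟨_, ⟨_root_.muWord A, [], ?_⟩, x, (1 - x) :: _root_.muWord Y, rfl⟩
    simp [applyMorphism, mu_eq]
  · rw [← List.append_assoc] at hw
    obtain ⟨rfl, -⟩ := List.append_inj' hw rfl
    have : HasOverlap (A ++ ([x] ++ Y ++ [x] ++ Y ++ [x]) ++ B) := ⟨_, ⟨A, B, rfl⟩, x, Y, rfl⟩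
    exact this.muWord.mono (List.prefix_append _ _).isInfix

/-- The word obtained by applying the morphism `mu` three times. -/
def muCube (w : List (Fin 2)) : List (Fin 2) := muWord (muWord (muWord w))

theorem muCube_append (u v : List (Fin 2)) : muCube (u ++ v) = muCube u ++ muCube v := by
  simp [muCube, applyMorphism]

theorem length_muCube (w : List (Fin 2)) : (muCube w).length = 8 * w.length := by
  simp only [muCube, length_muWord]; omega

/-- Every position of `muCube x` lies in the image of a two-letter factor of `x`, away from the
ends of that image unless it is close to an end of `muCube x`. -/
theorem exists_window (x : List (Fin 2)) (hx : 2 ≤ x.length) (i : ℕ) (hi : i ≤ 8 * x.length) :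
    ∃ (p : List (Fin 2)) (a b : Fin 2) (s : List (Fin 2)) (r : ℕ), x = p ++ ([a, b] ++ s) ∧
      i = 8 * p.length + r ∧ r ≤ 16 ∧ (r ≤ 1 → p = []) ∧ (15 ≤ r → s = []) := by
  induction x generalizing i with
  | nil => simp at hx
  | cons a x ih =>
    match x with
    | [] => simp at hx
    | [b] => exact ⟨[], a, b, [], i, rfl, by simp, by simpa using hi, by simp, by simp⟩
    | b :: c :: t =>
      by_cases h : i < 15
      · exact ⟨[], a, b, c :: t, i, rfl, by simp, by omega, by simp, by omega⟩
      · simp only [List.length_cons] at hi ih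
        obtain ⟨p, a', b', s, r, hxe, hir, hr, hp, hs⟩ := ih (by omega) (i - 8) (by omega)
        refine ⟨a :: p, a', b', s, r, by rw [hxe]; rfl, by simp only [List.length_cons]; omega,
          hr, fun h1 => ?_, hs⟩
        have := hp h1
        subst this
        simp at hir
        omega

theorem hasOverlap_insert_muCube_pair : ∀ a b : Fin 2, ∀ r < 17, ∀ c : Fin 2,
    HasOverlap ((muCube [a, b]).take r ++ c :: (muCube [a, b]).drop r) ∨
    (r ≤ 1 ∧ (muCube [a, b]).take r ++ c :: (muCube [a, b]).drop r = c :: muCube [a, b]) ∨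
    (15 ≤ r ∧ (muCube [a, b]).take r ++ c :: (muCube [a, b]).drop r = muCube [a, b] ++ [c]) := by
  decide +kernel

theorem hasOverlap_eraseIdx_muCube_pair : ∀ a b : Fin 2, ∀ r < 15, 0 < r →
    HasOverlap ((muCube [a, b]).eraseIdx r) := by
  decide +kernel

theorem hasOverlap_set_muCube_pair : ∀ a b : Fin 2, ∀ r < 16, ∀ c : Fin 2,
    some c ≠ (muCube [a, b])[r]? → HasOverlap ((muCube [a, b]).set r c) := by
  decide +kernel

theorem hasOverlap_insert_muCube {x : List (Fin 2)} (hx : 2 ≤ x.length)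
    (hl : ∀ c, HasOverlap (c :: muCube x)) (hr : ∀ c, HasOverlap (muCube x ++ [c]))
    (u v : List (Fin 2)) (huv : muCube x = u ++ v) (c : Fin 2) : HasOverlap (u ++ c :: v) := by
  have hlen := congrArg List.length huv
  rw [length_muCube, List.length_append] at hlen
  obtain ⟨p, a, b, s, r, rfl, hir, hr16, hp, hs⟩ := exists_window x hx u.length (by omega)
  have hW : (muCube [a, b]).length = 16 := length_muCube _
  have hP : (muCube p).length = 8 * p.length := length_muCube _
  rw [muCube_append, muCube_append] at huv hl hr
  have hu : u = muCube p ++ (muCube [a, b]).take r := by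
    have := congrArg (List.take u.length) huv
    rw [List.take_left, hir, ← hP, List.take_length_add_append,
      List.take_append_of_le_length (by omega)] at this
    exact this.symm
  have hv : v = (muCube [a, b]).drop r ++ muCube s := by
    have := congrArg (List.drop u.length) huv
    rw [List.drop_left, hir, ← hP, List.drop_length_add_append,
      List.drop_append_of_le_length (by omega)] at this
    exact this.symm
  have heq : u ++ c :: v = muCube p ++
      (((muCube [a, b]).take r ++ c :: (muCube [a, b]).drop r) ++ muCube s) := by
    simp [hu, hv]
  rw [heq]
  rcases hasOverlap_insert_muCube_pair a b r (by omega) c with h | ⟨h1, h⟩ | ⟨h1, h⟩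
  · exact h.append_append _ _
  · obtain rfl := hp h1
    rw [h]
    exact hl c
  · obtain rfl := hs h1
    rw [h]
    have h2 := hr c
    simpa [muCube, applyMorphism] using h2

theorem hasOverlap_eraseIdx_muCube {x : List (Fin 2)} (hx : 2 ≤ x.length) (i : ℕ) (h0 : 0 < i)
    (hi : i + 1 < (muCube x).length) : HasOverlap ((muCube x).eraseIdx i) := by
  rw [length_muCube] at hi
  obtain ⟨p, a, b, s, r, rfl, hir, hr16, hp, hs⟩ := exists_window x hx i (by omega)
  have hW : (muCube [a, b]).length = 16 := length_muCube _
  have hP : (muCube p).length = 8 * p.length := length_muCube _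
  have hr0 : 0 < r := by
    by_contra h
    obtain rfl := hp (by omega)
    simp at hir
    omega
  have hr15 : r < 15 := by
    by_contra h
    obtain rfl := hs (by omega)
    simp at hi
    omega
  rw [muCube_append, muCube_append, List.eraseIdx_append_of_length_le (by omega),
    List.eraseIdx_append_of_lt_length (by omega), show i - (muCube p).length = r by omega]
  exact (hasOverlap_eraseIdx_muCube_pair a b r hr15 hr0).append_append _ _

theorem hasOverlap_set_muCube {x : List (Fin 2)} (hx : 2 ≤ x.length) (i : ℕ)
    (hi : i < (muCube x).length) (c : Fin 2) (hc : c ≠ (muCube x).get ⟨i, hi⟩) :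
    HasOverlap ((muCube x).set i c) := by
  have hc' : some c ≠ (muCube x)[i]? := by
    rw [List.getElem?_eq_getElem hi]
    simpa using hc
  clear hc
  rw [length_muCube] at hi
  obtain ⟨p, a, b, s, r, rfl, hir, hr16, hp, hs⟩ := exists_window x hx i (by omega)
  have hW : (muCube [a, b]).length = 16 := length_muCube _
  have hP : (muCube p).length = 8 * p.length := length_muCube _
  have hr : r < 16 := by
    by_contra h
    obtain rfl := hs (by omega)
    simp at hi
    omega
  rw [muCube_append, muCube_append, List.getElem?_append_right (by omega),
    List.getElem?_append_left (by omega), show i - (muCube p).length = r by omega] at hc'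
  rw [muCube_append, muCube_append, List.set_append_right _ _ (by omega),
    List.set_append_left _ _ (by omega), show i - (muCube p).length = r by omega]
  exact (hasOverlap_set_muCube_pair a b r hr c hc').append_append _ _

theorem overlapFree_wSeq (i : ℕ) : OverlapFree (wSeq i) := by
  induction i with
  | zero => unfold OverlapFree; decide +kernel
  | succ i ih => exact ih.muWord

theorem hasOverlap_cons_wSeq (i : ℕ) (c : Fin 2) : HasOverlap (c :: wSeq i) := by
  induction i generalizing c with
  | zero => revert c; decide +kernel
  | succ i ih => exact (ih (1 - c)).cons_muWord

theorem hasOverlap_wSeq_concat (i : ℕ) (c : Fin 2) : HasOverlap (wSeq i ++ [c]) := by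
  induction i generalizing c with
  | zero => revert c; decide +kernel
  | succ i ih => exact (ih c).muWord_concat

theorem exists_wSeq_succ_eq_muCube (i : ℕ) :
    ∃ x : List (Fin 2), 2 ≤ x.length ∧ wSeq (i + 1) = muCube x := by
  induction i with
  | zero => exact ⟨[0, 0, 1, 1, 0, 0, 1, 1], by simp, by decide +kernel⟩
  | succ i ih =>
    obtain ⟨x, hx, h⟩ := ih
    refine ⟨muWord x, by rw [length_muWord]; omega, ?_⟩
    rw [wSeq, h]
    rfl

theorem hasOverlap_insert_wSeq_zero : ∀ r < 33, ∀ c : Fin 2,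
    HasOverlap ((wSeq 0).take r ++ c :: (wSeq 0).drop r) := by
  decide +kernel

theorem hasOverlap_eraseIdx_wSeq_zero : ∀ i < 31, 0 < i → HasOverlap ((wSeq 0).eraseIdx i) := by
  decide +kernel

theorem hasOverlap_set_wSeq_zero : ∀ i < 32, ∀ c : Fin 2, some c ≠ (wSeq 0)[i]? →
    HasOverlap ((wSeq 0).set i c) := by
  decide +kernel

theorem hasOverlap_insert_wSeq (i : ℕ) (u v : List (Fin 2)) (huv : wSeq i = u ++ v) (c : Fin 2) :
    HasOverlap (u ++ c :: v) := by
  cases i with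
  | zero =>
    have hlen : u.length < 33 := by
      have := congrArg List.length huv
      simp [wSeq] at this
      omega
    have := hasOverlap_insert_wSeq_zero u.length hlen c
    rwa [huv, List.take_left, List.drop_left] at this
  | succ i =>
    obtain ⟨x, hx, h⟩ := exists_wSeq_succ_eq_muCube i
    have hl := hasOverlap_cons_wSeq (i + 1)
    have hr := hasOverlap_wSeq_concat (i + 1)
    rw [h] at huv hl hr
    exact hasOverlap_insert_muCube hx hl hr u v huv c

theorem hasOverlap_eraseIdx_wSeq (i j : ℕ) (h0 : 0 < j) (hj : j + 1 < (wSeq i).length) :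
    HasOverlap ((wSeq i).eraseIdx j) := by
  cases i with
  | zero =>
    have : j + 1 < 32 := hj
    exact hasOverlap_eraseIdx_wSeq_zero j (by omega) h0
  | succ i =>
    obtain ⟨x, hx, h⟩ := exists_wSeq_succ_eq_muCube i
    rw [h] at hj ⊢
    exact hasOverlap_eraseIdx_muCube hx j h0 hj

theorem hasOverlap_set_wSeq (i j : ℕ) (hj : j < (wSeq i).length) (c : Fin 2)
    (hc : c ≠ (wSeq i).get ⟨j, hj⟩) : HasOverlap ((wSeq i).set j c) := by
  cases i with
  | zero =>
    refine hasOverlap_set_wSeq_zero j hj c ?_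
    rw [List.getElem?_eq_getElem hj]
    simpa using hc
  | succ i =>
    obtain ⟨x, hx, h⟩ := exists_wSeq_succ_eq_muCube i
    generalize wSeq (i + 1) = w at *
    subst h
    exact hasOverlap_set_muCube hx j hj c hc

theorem three_le_length_wSeq (i : ℕ) : 3 ≤ (wSeq i).length := by
  induction i with
  | zero => simp [wSeq]
  | succ i ih => rw [wSeq, length_muWord]; omega

theorem wSeq_extremal_irreducible_delicate (i : ℕ) :
    OverlapFree (wSeq i) ∧ ExtremalOverlapFree (wSeq i) ∧
      IrreducibleOverlapFree (wSeq i) ∧ DelicateOverlapFree (wSeq i) :=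
  have hfree := overlapFree_wSeq i
  have hlen := three_le_length_wSeq i
  ⟨hfree, ⟨hfree, hasOverlap_insert_wSeq i⟩, ⟨hfree, hlen, hasOverlap_eraseIdx_wSeq i⟩,
    List.ne_nil_of_length_pos (by omega), hfree, hasOverlap_set_wSeq i⟩
end
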